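/- arXiv:0710.5939 — 8 statements merged into one kernel-verified Lean document; each statement's English description precedes it below -/
import Mathlib

section
/- Let e₁, e₂, e₃ be distinct complex numbers with e₁ + e₂ + e₃ = 0, f(u) = (u − e₁)(u − e₂)(u − e₃), and P(ρ, u, w) = ρ² + (2u + w)·f(u) − f′(u)²/4. Then at every point (ρ, u, w) ∈ ℂ³ with P(ρ, u, w) = 0, the gradient of P is nonzero; in fact (∂P/∂ρ, ∂P/∂w) = (2ρ, f(u)) ≠ (0, 0) at every such point. In particular the surface M = {P = 0} is smooth. -/
/-- The moduli space `M = {P = 0}`, where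
`P(ρ, u, w) = ρ² + (2u + w) f(u) − f′(u)²/4` with `f(u) = (u − e₁)(u − e₂)(u − e₃)` and
`e₁, e₂, e₃` distinct with `e₁ + e₂ + e₃ = 0`, is smooth: at every point of `M` the
gradient of `P` is nonzero; in fact `(∂P/∂ρ, ∂P/∂w) = (2ρ, f(u)) ≠ (0, 0)` there. -/
theorem moduli_space_smooth (e₁ e₂ e₃ : ℂ)
    (h12 : e₁ ≠ e₂) (h13 : e₁ ≠ e₃) (h23 : e₂ ≠ e₃)
    (hsum : e₁ + e₂ + e₃ = 0)
    (P : ℂ → ℂ → ℂ → ℂ)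
    (hP : P = fun ρ u w => ρ ^ 2 + (2 * u + w) * ((u - e₁) * (u - e₂) * (u - e₃)) -
      (deriv (fun X : ℂ => (X - e₁) * (X - e₂) * (X - e₃)) u) ^ 2 / 4)
    (ρ u w : ℂ) (hzero : P ρ u w = 0) :
    deriv (fun ρ' => P ρ' u w) ρ = 2 * ρ ∧
    deriv (fun w' => P ρ u w') w = (u - e₁) * (u - e₂) * (u - e₃) ∧
    ¬(2 * ρ = 0 ∧ (u - e₁) * (u - e₂) * (u - e₃) = 0) := by
  have hf : deriv (fun X : ℂ => (X - e₁) * (X - e₂) * (X - e₃)) u =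
      (u - e₂) * (u - e₃) + (u - e₁) * (u - e₃) + (u - e₁) * (u - e₂) := by
    refine (((((hasDerivAt_id u).sub_const e₁).mul ((hasDerivAt_id u).sub_const e₂)).mul
      ((hasDerivAt_id u).sub_const e₃)).congr_deriv ?_).deriv
    simp only [id, Pi.mul_apply]
    ring
  subst hP
  simp only [hf] at hzero ⊢
  refine ⟨?_, ?_, ?_⟩
  · simp
  · simp
  · rintro ⟨hρ, h⟩
    obtain rfl : ρ = 0 := by simpa using hρ
    rw [h] at hzero
    have hd : (u - e₂) * (u - e₃) + (u - e₁) * (u - e₃) + (u - e₁) * (u - e₂) = 0 := by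
      simpa using hzero
    rcases mul_eq_zero.1 h with h | h
    · rcases mul_eq_zero.1 h with h | h
      · obtain rfl := sub_eq_zero.1 h
        simp [sub_eq_zero, h12, h13] at hd
      · obtain rfl := sub_eq_zero.1 h
        simp [sub_eq_zero, h12.symm, h23] at hd
    · obtain rfl := sub_eq_zero.1 h
      simp [sub_eq_zero, h13.symm, h23.symm] at hd
end

section
/- Let e₁, e₂, e₃ be distinct complex numbers with e₁ + e₂ + e₃ = 0, f(u) = (u − e₁)(u − e₂)(u − e₃), and for w ∈ ℂ set g_w(u) = −(2u + w)·f(u) + f′(u)²/4. Then there exists u ∈ ℂ with g_w(u) = 0 and g_w′(u) = 0 (equivalently, the quartic g_w has a repeated root, i.e. the fiber F_w is singular) if and only if w ∈ {e₁, e₂, e₃}. -/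
/-- The derivative of a monic cubic given by its roots, when the roots sum to zero. -/
theorem hasDerivAt_cubic_of_sum_eq_zero {e₁ e₂ e₃ : ℂ} (hsum : e₁ + e₂ + e₃ = 0) (u : ℂ) :
    HasDerivAt (fun X : ℂ => (X - e₁) * (X - e₂) * (X - e₃))
      (3 * u ^ 2 + (e₁ * e₂ + e₁ * e₃ + e₂ * e₃)) u := by
  refine ((((hasDerivAt_id u).sub_const e₁).mul ((hasDerivAt_id u).sub_const e₂)).mul
    ((hasDerivAt_id u).sub_const e₃)).congr_deriv ?_
  simp only [id, Pi.mul_apply]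
  linear_combination -2 * u * hsum

/-- The derivative of the quartic `-(2u + w) f(u) + f′(u)² / 4`, where `f` is a monic cubic whose
roots sum to zero, is `-2 f(u) + (u - w) f′(u)`. -/
theorem hasDerivAt_quartic_of_sum_eq_zero {e₁ e₂ e₃ : ℂ} (hsum : e₁ + e₂ + e₃ = 0) (w u : ℂ) :
    HasDerivAt (fun u : ℂ => -(2 * u + w) * ((u - e₁) * (u - e₂) * (u - e₃)) +
        (3 * u ^ 2 + (e₁ * e₂ + e₁ * e₃ + e₂ * e₃)) ^ 2 / 4)
      (-2 * ((u - e₁) * (u - e₂) * (u - e₃)) +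
        (u - w) * (3 * u ^ 2 + (e₁ * e₂ + e₁ * e₃ + e₂ * e₃))) u := by
  have hlin : HasDerivAt (fun u : ℂ => -(2 * u + w)) (-(2 * 1)) u :=
    (((hasDerivAt_id u).const_mul 2).add_const w).neg
  have hquad : HasDerivAt (fun u : ℂ => 3 * u ^ 2 + (e₁ * e₂ + e₁ * e₃ + e₂ * e₃))
      (3 * (2 * u)) u := by
    simpa using ((hasDerivAt_pow 2 u).const_mul 3).add_const (e₁ * e₂ + e₁ * e₃ + e₂ * e₃)
  refine ((hlin.mul (hasDerivAt_cubic_of_sum_eq_zero hsum u)).add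
    ((hquad.pow 2).div_const 4)).congr_deriv ?_
  push_cast
  ring

/-- A root of a cubic with distinct roots summing to zero is not a root of its derivative. -/
theorem cubic_deriv_ne_zero {e₁ e₂ e₃ u : ℂ} (h12 : e₁ ≠ e₂) (h13 : e₁ ≠ e₃) (h23 : e₂ ≠ e₃)
    (hsum : e₁ + e₂ + e₃ = 0) (hu : (u - e₁) * (u - e₂) * (u - e₃) = 0) :
    3 * u ^ 2 + (e₁ * e₂ + e₁ * e₃ + e₂ * e₃) ≠ 0 := by
  have key : 3 * u ^ 2 + (e₁ * e₂ + e₁ * e₃ + e₂ * e₃) =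
      (u - e₁) * (u - e₂) + (u - e₁) * (u - e₃) + (u - e₂) * (u - e₃) := by
    linear_combination 2 * u * hsum
  rw [key]
  rcases mul_eq_zero.mp hu with h | h
  · rcases mul_eq_zero.mp h with h | h <;> obtain rfl := sub_eq_zero.mp h
    · simpa using ⟨sub_ne_zero.mpr h12, sub_ne_zero.mpr h13⟩
    · simpa using ⟨sub_ne_zero.mpr h12.symm, sub_ne_zero.mpr h23⟩
  · obtain rfl := sub_eq_zero.mp h
    simpa using ⟨sub_ne_zero.mpr h13.symm, sub_ne_zero.mpr h23.symm⟩

/-- The fiber `F_w = {ρ² = g_w(u)}` of the Hitchin fibration is singular — i.e. the quartic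
`g_w(u) = −(2u + w) f(u) + f′(u)²/4` has a repeated root — if and only if
`w ∈ {e₁, e₂, e₃}`. Here `f(u) = (u − e₁)(u − e₂)(u − e₃)` with `e₁, e₂, e₃` distinct
and `e₁ + e₂ + e₃ = 0`. -/
theorem singular_fibers_iff (e₁ e₂ e₃ : ℂ)
    (h12 : e₁ ≠ e₂) (h13 : e₁ ≠ e₃) (h23 : e₂ ≠ e₃)
    (hsum : e₁ + e₂ + e₃ = 0) (w : ℂ)
    (g : ℂ → ℂ)
    (hg : g = fun u => -(2 * u + w) * ((u - e₁) * (u - e₂) * (u - e₃)) +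
      (deriv (fun X : ℂ => (X - e₁) * (X - e₂) * (X - e₃)) u) ^ 2 / 4) :
    (∃ u : ℂ, g u = 0 ∧ deriv g u = 0) ↔ (w = e₁ ∨ w = e₂ ∨ w = e₃) := by
  have hg' : g = fun u => -(2 * u + w) * ((u - e₁) * (u - e₂) * (u - e₃)) +
      (3 * u ^ 2 + (e₁ * e₂ + e₁ * e₃ + e₂ * e₃)) ^ 2 / 4 := by
    rw [hg]
    funext u
    rw [(hasDerivAt_cubic_of_sum_eq_zero hsum u).deriv]
  have hd (u : ℂ) : deriv g u = -2 * ((u - e₁) * (u - e₂) * (u - e₃)) +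
      (u - w) * (3 * u ^ 2 + (e₁ * e₂ + e₁ * e₃ + e₂ * e₃)) := by
    rw [hg']
    exact (hasDerivAt_quartic_of_sum_eq_zero hsum w u).deriv
  have hroot : (w = e₁ ∨ w = e₂ ∨ w = e₃) ↔ (w - e₁) * (w - e₂) * (w - e₃) = 0 := by
    simp only [mul_eq_zero, sub_eq_zero, or_assoc]
  have expand (x : ℂ) : (x - e₁) * (x - e₂) * (x - e₃) =
      x ^ 3 + (e₁ * e₂ + e₁ * e₃ + e₂ * e₃) * x - e₁ * e₂ * e₃ := by
    linear_combination -x ^ 2 * hsum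
  have hne (u : ℂ) := cubic_deriv_ne_zero (u := u) h12 h13 h23 hsum
  simp only [hroot, hd]
  simp only [hg', expand] at hne ⊢
  generalize e₁ * e₂ + e₁ * e₃ + e₂ * e₃ = a at hne ⊢
  generalize e₁ * e₂ * e₃ = b at hne ⊢
  constructor
  · rintro ⟨u, h0, h1⟩
    have hprod : (3 * u ^ 2 + a) * (a - (u ^ 2 - 2 * u * w - 2 * w ^ 2)) = 0 := by
      linear_combination 4 * h0 - 2 * (2 * u + w) * h1
    rcases mul_eq_zero.mp hprod with h | h
    · exact absurd h (hne u (by linear_combination (u - w) / 2 * h - h1 / 2))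
    · linear_combination (w - u) / 2 * h - h1 / 2
  · intro hw
    obtain ⟨s, hs⟩ := IsAlgClosed.exists_pow_nat_eq (a + 3 * w ^ 2) two_pos
    obtain rfl : a = s ^ 2 - 3 * w ^ 2 := by linear_combination -hs
    obtain rfl : b = w ^ 3 + (s ^ 2 - 3 * w ^ 2) * w := by linear_combination -hw
    exact ⟨w + s, by ring, by ring⟩
end

section
/- Let e₁, e₂, e₃ be distinct complex numbers with e₁ + e₂ + e₃ = 0, f(u) = (u − e₁)(u − e₂)(u − e₃), g_{e₁}(u) = −(2u + e₁)·f(u) + f′(u)²/4, and D = (e₁ − e₂)(e₁ − e₃) ≠ 0. Then the set of singular points of the affine curve F_{e₁} = {(ρ, u) ∈ ℂ² : ρ² = g_{e₁}(u)} — that is, points of F_{e₁} where ρ = 0 and g_{e₁}′(u) = 0 — is exactly {(0, u) : (u − e₁)² = D}, which consists of precisely two points; and this set coincides with the intersection of the two components ρ = (1/2)((u−e₁)² − D) and ρ = −(1/2)((u−e₁)² − D) of F_{e₁}. -/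
theorem hasDerivAt_cubic (a b c u : ℂ) :
    HasDerivAt (fun X : ℂ => (X - a) * (X - b) * (X - c))
      ((u - b) * (u - c) + (u - a) * (u - c) + (u - a) * (u - b)) u := by
  have h := (((hasDerivAt_id u).sub_const a).mul ((hasDerivAt_id u).sub_const b)).mul
    ((hasDerivAt_id u).sub_const c)
  refine h.congr_deriv ?_
  simp only [id, Pi.mul_apply]
  ring

theorem hasDerivAt_quarter_sq (a D u : ℂ) :
    HasDerivAt (fun X : ℂ => ((X - a) ^ 2 - D) ^ 2 / 4) ((u - a) * ((u - a) ^ 2 - D)) u := by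
  have h := (((((hasDerivAt_id u).sub_const a).pow 2).sub_const D).pow 2).div_const 4
  refine h.congr_deriv ?_
  simp only [id, Pi.pow_apply]
  push_cast
  ring

/-- At `w = e₁` the quartic `g_w` is a perfect square. -/
theorem quartic_eq_quarter_sq {e₁ e₂ e₃ : ℂ} (hsum : e₁ + e₂ + e₃ = 0) (u : ℂ) :
    -(2 * u + e₁) * ((u - e₁) * (u - e₂) * (u - e₃)) +
      (deriv (fun X : ℂ => (X - e₁) * (X - e₂) * (X - e₃)) u) ^ 2 / 4
      = ((u - e₁) ^ 2 - (e₁ - e₂) * (e₁ - e₃)) ^ 2 / 4 := by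
  rw [(hasDerivAt_cubic e₁ e₂ e₃ u).deriv]
  obtain rfl : e₃ = -e₁ - e₂ := by linear_combination hsum
  ring

theorem ncard_zero_prod_sq_eq (a : ℂ) {D : ℂ} (hD : D ≠ 0) :
    ({p : ℂ × ℂ | p.1 = 0 ∧ (p.2 - a) ^ 2 = D}).ncard = 2 := by
  obtain ⟨r, rfl⟩ := IsAlgClosed.exists_pow_nat_eq D (n := 2) two_pos
  have hr : r ≠ 0 := by simpa using hD
  rw [Set.ncard_eq_two]
  refine ⟨(0, a + r), (0, a - r), fun h => hr ?_, ?_⟩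
  · have h' : a + r = a - r := congrArg Prod.snd h
    linear_combination h' / 2
  · ext ⟨x, u⟩
    simp only [Set.mem_ofPred_eq, Set.mem_insert_iff, Set.mem_singleton_iff, Prod.mk.injEq,
      sq_eq_sq_iff_eq_or_eq_neg, sub_eq_iff_eq_add, ← and_or_left]
    rw [add_comm r a, neg_add_eq_sub]

/-- The singular points of the singular Hitchin fiber `F_{e₁} = {(ρ, u) : ρ² = g_{e₁}(u)}`
(points with `ρ = 0` and `g_{e₁}′(u) = 0`) are exactly the points `(0, u)` with
`(u − e₁)² = D`, where `D = (e₁ − e₂)(e₁ − e₃) ≠ 0`; there are exactly two of them, and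
they form the intersection of the two components `ρ = ±(1/2)((u − e₁)² − D)` of `F_{e₁}`. -/
theorem singular_points_of_singular_fiber (e₁ e₂ e₃ : ℂ)
    (h12 : e₁ ≠ e₂) (h13 : e₁ ≠ e₃) (h23 : e₂ ≠ e₃)
    (hsum : e₁ + e₂ + e₃ = 0)
    (g : ℂ → ℂ)
    (hg : g = fun u => -(2 * u + e₁) * ((u - e₁) * (u - e₂) * (u - e₃)) +
      (deriv (fun X : ℂ => (X - e₁) * (X - e₂) * (X - e₃)) u) ^ 2 / 4)
    (D : ℂ) (hD : D = (e₁ - e₂) * (e₁ - e₃)) :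
    D ≠ 0 ∧
    {p : ℂ × ℂ | p.1 ^ 2 = g p.2 ∧ p.1 = 0 ∧ deriv g p.2 = 0}
      = {p : ℂ × ℂ | p.1 = 0 ∧ (p.2 - e₁) ^ 2 = D} ∧
    ({p : ℂ × ℂ | p.1 = 0 ∧ (p.2 - e₁) ^ 2 = D}).ncard = 2 ∧
    {p : ℂ × ℂ | p.1 ^ 2 = g p.2 ∧ p.1 = 0 ∧ deriv g p.2 = 0}
      = {p : ℂ × ℂ | p.1 = (1 / 2) * ((p.2 - e₁) ^ 2 - D)} ∩
        {p : ℂ × ℂ | p.1 = -(1 / 2) * ((p.2 - e₁) ^ 2 - D)} := by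
  have hD0 : D ≠ 0 := hD ▸ mul_ne_zero (sub_ne_zero.2 h12) (sub_ne_zero.2 h13)
  have hg' : g = fun u => ((u - e₁) ^ 2 - D) ^ 2 / 4 := by
    rw [hg, hD]
    exact funext (quartic_eq_quarter_sq hsum)
  have hsing : {p : ℂ × ℂ | p.1 ^ 2 = g p.2 ∧ p.1 = 0 ∧ deriv g p.2 = 0}
      = {p : ℂ × ℂ | p.1 = 0 ∧ (p.2 - e₁) ^ 2 = D} := by
    ext ⟨x, u⟩
    simp only [Set.mem_ofPred_eq, hg', (hasDerivAt_quarter_sq e₁ D u).deriv]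
    constructor
    · rintro ⟨h, rfl, -⟩
      have h' : ((u - e₁) ^ 2 - D) ^ 2 = 0 := by linear_combination -4 * h
      exact ⟨rfl, sub_eq_zero.1 (pow_eq_zero_iff two_ne_zero |>.1 h')⟩
    · rintro ⟨rfl, h⟩
      simp [h]
  refine ⟨hD0, hsing, ncard_zero_prod_sq_eq e₁ hD0, hsing.trans ?_⟩
  ext ⟨x, u⟩
  simp only [Set.mem_ofPred_eq, Set.mem_inter_iff]
  constructor
  · rintro ⟨rfl, h⟩
    simp [h]
  · rintro ⟨h₁, h₂⟩
    exact ⟨by linear_combination (h₁ + h₂) / 2, by linear_combination h₂ - h₁⟩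
end

section
/- Let e₁, e₂, e₃ be distinct complex numbers with e₁ + e₂ + e₃ = 0, f(u) = (u − e₁)(u − e₂)(u − e₃), and g_w(u) = −(2u + w)·f(u) + f′(u)²/4. Define, for u ≠ e₁, the map T₁(u, ρ) = (u′, ρ′) with u′ = (e₁u + e₂e₃ − e₁e₃ − e₁e₂)/(u − e₁) and ρ′ = −(e₁ − e₂)(e₁ − e₃)·ρ/(u − e₁)². Then: (i) u′ ≠ e₁, and T₁ is an involution, i.e. T₁(T₁(u, ρ)) = (u, ρ); (ii) T₁ preserves every Hitchin fiber: for every w ∈ ℂ, if ρ² = g_w(u) then ρ′² = g_w(u′). -/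
/-- The derivative of a monic cubic given by its roots. -/
theorem deriv_cubic_of_roots (a b c x : ℂ) :
    deriv (fun X : ℂ => (X - a) * (X - b) * (X - c)) x =
      (x - b) * (x - c) + (x - a) * (x - c) + (x - a) * (x - b) := by
  have h := (((hasDerivAt_id x).sub_const a).mul ((hasDerivAt_id x).sub_const b)).mul
    ((hasDerivAt_id x).sub_const c)
  refine (HasDerivAt.deriv h).trans ?_
  simp only [id, Pi.mul_apply]
  ring

/-- The twist `T₁` by the order-2 line bundle corresponding to `(e₁, 0)`:
`T₁(u, ρ) = (u′, ρ′)` with `u′ = (e₁u + e₂e₃ − e₁e₃ − e₁e₂)/(u − e₁)` and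
`ρ′ = −(e₁ − e₂)(e₁ − e₃)ρ/(u − e₁)²`, is a well-defined involution on `{u ≠ e₁}` and
preserves every fiber of the Hitchin fibration `ρ² = g_w(u)`. -/
theorem twist_involution_preserves_fibers (e₁ e₂ e₃ : ℂ)
    (h12 : e₁ ≠ e₂) (h13 : e₁ ≠ e₃) (h23 : e₂ ≠ e₃)
    (hsum : e₁ + e₂ + e₃ = 0)
    (u ρ u' ρ' : ℂ) (hu : u ≠ e₁)
    (hu' : u' = (e₁ * u + e₂ * e₃ - e₁ * e₃ - e₁ * e₂) / (u - e₁))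
    (hρ' : ρ' = -((e₁ - e₂) * (e₁ - e₃)) * ρ / (u - e₁) ^ 2) :
    u' ≠ e₁ ∧
    (e₁ * u' + e₂ * e₃ - e₁ * e₃ - e₁ * e₂) / (u' - e₁) = u ∧
    -((e₁ - e₂) * (e₁ - e₃)) * ρ' / (u' - e₁) ^ 2 = ρ ∧
    ∀ w : ℂ,
      ρ ^ 2 = -(2 * u + w) * ((u - e₁) * (u - e₂) * (u - e₃)) +
        (deriv (fun X : ℂ => (X - e₁) * (X - e₂) * (X - e₃)) u) ^ 2 / 4 →
      ρ' ^ 2 = -(2 * u' + w) * ((u' - e₁) * (u' - e₂) * (u' - e₃)) +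
        (deriv (fun X : ℂ => (X - e₁) * (X - e₂) * (X - e₃)) u') ^ 2 / 4 := by
  have ht : u - e₁ ≠ 0 := sub_ne_zero.mpr hu
  have ha : e₁ - e₂ ≠ 0 := sub_ne_zero.mpr h12
  have hb : e₁ - e₃ ≠ 0 := sub_ne_zero.mpr h13
  have hsub : u' - e₁ = (e₁ - e₂) * (e₁ - e₃) / (u - e₁) := by
    rw [hu']
    field_simp
    ring
  have hne : u' - e₁ ≠ 0 := by
    rw [hsub]
    exact div_ne_zero (mul_ne_zero ha hb) ht
  refine ⟨sub_ne_zero.mp hne, ?_, ?_, fun w hw => ?_⟩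
  · have hmul : (u' - e₁) * (u - e₁) = (e₁ - e₂) * (e₁ - e₃) := by
      rw [hsub, div_mul_cancel₀ _ ht]
    rw [div_eq_iff hne]
    linear_combination -hmul
  · rw [hsub, hρ']
    field_simp
  · rw [deriv_cubic_of_roots] at hw ⊢
    have hsq : ρ' ^ 2 = ((e₁ - e₂) * (e₁ - e₃)) ^ 2 / (u - e₁) ^ 4 * ρ ^ 2 := by
      rw [hρ']
      field_simp
    have hu₁ : u' = e₁ + (e₁ - e₂) * (e₁ - e₃) / (u - e₁) := by
      rw [← hsub]
      ring
    obtain rfl : e₃ = -e₁ - e₂ := by linear_combination hsum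
    rw [hsq, hw, hu₁]
    field_simp
    ring
end

section
/- Let e₁, e₂, e₃ be distinct complex numbers with e₁ + e₂ + e₃ = 0, and let D = (e₁ − e₂)(e₁ − e₃). Define, for u ≠ e₁, T₁(u, ρ) = ((e₁u + e₂e₃ − e₁e₃ − e₁e₂)/(u − e₁), −D·ρ/(u − e₁)²). Then the fixed points of T₁ on {(u, ρ) ∈ ℂ² : u ≠ e₁} are exactly the two points (u, ρ) with (u − e₁)² = D and ρ = 0. -/
/-- The fixed points of the involution
`T₁(u, ρ) = ((e₁u + e₂e₃ − e₁e₃ − e₁e₂)/(u − e₁), −Dρ/(u − e₁)²)` on `{u ≠ e₁}`,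
where `D = (e₁ − e₂)(e₁ − e₃)`, are exactly the two points with `(u − e₁)² = D`
and `ρ = 0`. -/
theorem twist_fixed_points (e₁ e₂ e₃ : ℂ)
    (h12 : e₁ ≠ e₂) (h13 : e₁ ≠ e₃) (h23 : e₂ ≠ e₃)
    (hsum : e₁ + e₂ + e₃ = 0)
    (D : ℂ) (hD : D = (e₁ - e₂) * (e₁ - e₃)) :
    (∀ u ρ : ℂ, u ≠ e₁ →
      (((e₁ * u + e₂ * e₃ - e₁ * e₃ - e₁ * e₂) / (u - e₁) = u ∧
        -D * ρ / (u - e₁) ^ 2 = ρ) ↔ ((u - e₁) ^ 2 = D ∧ ρ = 0))) ∧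
    ({p : ℂ × ℂ | (p.1 - e₁) ^ 2 = D ∧ p.2 = 0}).ncard = 2 := by
  have hD0 : D ≠ 0 := hD ▸ mul_ne_zero (sub_ne_zero.2 h12) (sub_ne_zero.2 h13)
  refine ⟨fun u ρ hu => ?_, ?_⟩
  · have hu' : u - e₁ ≠ 0 := sub_ne_zero.2 hu
    rw [div_eq_iff hu', div_eq_iff (pow_ne_zero 2 hu')]
    constructor
    · rintro ⟨h₁, h₂⟩
      have hsq : (u - e₁) ^ 2 = D := by linear_combination -h₁ - hD
      rw [hsq] at h₂
      have h₃ : D * ρ = 0 := by linear_combination -h₂ / 2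
      exact ⟨hsq, (mul_eq_zero.1 h₃).resolve_left hD0⟩
    · rintro ⟨hsq, rfl⟩
      exact ⟨by linear_combination -hsq - hD, by simp⟩
  · obtain ⟨s, hs⟩ := IsAlgClosed.exists_pow_nat_eq D (n := 2) (by norm_num)
    have hs0 : s ≠ 0 := by
      rintro rfl
      exact hD0 (by simpa using hs.symm)
    have hset : {p : ℂ × ℂ | (p.1 - e₁) ^ 2 = D ∧ p.2 = 0} = {(e₁ + s, 0), (e₁ - s, 0)} := by
      ext ⟨u, ρ⟩
      simp only [Set.mem_ofPred_eq, Set.mem_insert_iff, Set.mem_singleton_iff, Prod.mk.injEq,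
        ← or_and_right, ← hs, sq_eq_sq_iff_eq_or_eq_neg, sub_eq_iff_eq_add', sub_eq_add_neg e₁ s]
    rw [hset, Set.ncard_pair]
    intro h
    have h₁ : e₁ + s = e₁ - s := congrArg Prod.fst h
    exact hs0 (by linear_combination h₁ / 2)
end

section
/- Let e₁, e₂, e₃ be distinct complex numbers, let w ∈ ℂ, and let b = (b₁, b₂, b₃) ∈ ℂ³ satisfy b₁² + b₂² + b₃² = 1 and e₁b₁² + e₂b₂² + e₃b₃² = w. Then the vectors (b₁, b₂, b₃) and (e₁b₁, e₂b₂, e₃b₃) are ℂ-linearly dependent if and only if there is an index i ∈ {1, 2, 3} with w = eᵢ, bᵢ² = 1, and bⱼ = 0 for all j ≠ i. In particular, the intersection of the two quadrics Σbᵢ² = 1 and Σeᵢbᵢ² = w has a point where the differentials of the two defining equations are linearly dependent if and only if w ∈ {e₁, e₂, e₃}, and for w = eᵢ such points are exactly the two points with bᵢ = ±1. -/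
theorem eq_zero_or_eq_zero_of_common_root {R : Type*} [CommRing R] [IsDomain R]
    {s t e e' b b' : R} (hne : e ≠ e') (ht : t ≠ 0)
    (h : s * b + t * (e * b) = 0) (h' : s * b' + t * (e' * b') = 0) : b = 0 ∨ b' = 0 := by
  have hprod : t * (e - e') * (b * b') = 0 := by linear_combination b' * h - b * h'
  exact mul_eq_zero.mp
    ((mul_eq_zero.mp hprod).resolve_left (mul_ne_zero ht (sub_ne_zero.mpr hne)))


/-- On the intersection of the two quadrics `Σ bᵢ² = 1`, `Σ eᵢ bᵢ² = w` (the Hitchin fiber on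
the improper component), the differentials of the two defining equations, i.e. the vectors
`(b₁, b₂, b₃)` and `(e₁b₁, e₂b₂, e₃b₃)`, are linearly dependent exactly at the points where
`w = eᵢ`, `bᵢ² = 1`, and `bⱼ = 0` for `j ≠ i`. -/
theorem singular_points_improper_component (e₁ e₂ e₃ : ℂ)
    (h12 : e₁ ≠ e₂) (h13 : e₁ ≠ e₃) (h23 : e₂ ≠ e₃)
    (w b₁ b₂ b₃ : ℂ)
    (hq1 : b₁ ^ 2 + b₂ ^ 2 + b₃ ^ 2 = 1)
    (hq2 : e₁ * b₁ ^ 2 + e₂ * b₂ ^ 2 + e₃ * b₃ ^ 2 = w) :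
    ¬ LinearIndependent ℂ
        ![(![b₁, b₂, b₃] : Fin 3 → ℂ), ![e₁ * b₁, e₂ * b₂, e₃ * b₃]]
      ↔ ((w = e₁ ∧ b₁ ^ 2 = 1 ∧ b₂ = 0 ∧ b₃ = 0) ∨
         (w = e₂ ∧ b₂ ^ 2 = 1 ∧ b₁ = 0 ∧ b₃ = 0) ∨
         (w = e₃ ∧ b₃ ^ 2 = 1 ∧ b₁ = 0 ∧ b₂ = 0)) := by
  rw [LinearIndependent.pair_iff]
  constructor
  · intro h
    push Not at h
    obtain ⟨s, t, hst, hne⟩ := h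
    have h1 : s * b₁ + t * (e₁ * b₁) = 0 := by simpa using congrFun hst 0
    have h2 : s * b₂ + t * (e₂ * b₂) = 0 := by simpa using congrFun hst 1
    have h3 : s * b₃ + t * (e₃ * b₃) = 0 := by simpa using congrFun hst 2
    have ht : t ≠ 0 := by
      rintro rfl
      have hs : s = 0 := by
        linear_combination (-s) * hq1 + b₁ * h1 + b₂ * h2 + b₃ * h3
      exact hne hs rfl
    rcases eq_zero_or_eq_zero_of_common_root h12 ht h1 h2 with rfl | rfl
    · rcases eq_zero_or_eq_zero_of_common_root h23 ht h2 h3 with rfl | rfl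
      · have hb : b₃ ^ 2 = 1 := by simpa using hq1
        exact Or.inr (Or.inr ⟨by simpa [hb] using hq2.symm, hb, rfl, rfl⟩)
      · have hb : b₂ ^ 2 = 1 := by simpa using hq1
        exact Or.inr (Or.inl ⟨by simpa [hb] using hq2.symm, hb, rfl, rfl⟩)
    · rcases eq_zero_or_eq_zero_of_common_root h13 ht h1 h3 with rfl | rfl
      · have hb : b₃ ^ 2 = 1 := by simpa using hq1
        exact Or.inr (Or.inr ⟨by simpa [hb] using hq2.symm, hb, rfl, rfl⟩)
      · have hb : b₁ ^ 2 = 1 := by simpa using hq1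
        exact Or.inl ⟨by simpa [hb] using hq2.symm, hb, rfl, rfl⟩
  · have dependent : ∀ e : ℂ, e * b₁ = e₁ * b₁ → e * b₂ = e₂ * b₂ → e * b₃ = e₃ * b₃ →
        ¬ ∀ s t : ℂ, s • (![b₁, b₂, b₃] : Fin 3 → ℂ) + t • ![e₁ * b₁, e₂ * b₂, e₃ * b₃] = 0 →
          s = 0 ∧ t = 0 := by
      intro e h1 h2 h3 h
      have hzero := h e (-1) (by
        ext i
        fin_cases i <;> simp [h1, h2, h3])
      exact neg_ne_zero.mpr one_ne_zero hzero.2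
    rintro (⟨-, -, rfl, rfl⟩ | ⟨-, -, rfl, rfl⟩ | ⟨-, -, rfl, rfl⟩)
    · exact dependent e₁ rfl (by simp) (by simp)
    · exact dependent e₂ (by simp) rfl (by simp)
    · exact dependent e₃ (by simp) (by simp) rfl
end

section
/- Let e₁, e₂, e₃ be distinct complex numbers and b = (b₁, b₂, b₃) ∈ ℂ³ with b₁² + b₂² + b₃² = 1 and e₁b₁² + e₂b₂² + e₃b₃² = w. Set t = e₁²b₁² + e₂²b₂² + e₃²b₃² and z = b₁b₂b₃. Then z² · ∏_{1≤i<j≤3}(eᵢ − eⱼ)² = −∏_{1≤i<j≤3}(t − w(eᵢ + eⱼ) + eᵢeⱼ). -/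
/-- The equation of the SO₃ moduli space on the improper component: with
`t = Σ eᵢ² bᵢ²` and `z = b₁b₂b₃` on the intersection of the quadrics `Σ bᵢ² = 1` and
`Σ eᵢ bᵢ² = w`, one has `z² ∏_{i<j}(eᵢ − eⱼ)² = −∏_{i<j}(t − w(eᵢ + eⱼ) + eᵢeⱼ)`. -/
theorem so3_moduli_equation (e₁ e₂ e₃ w b₁ b₂ b₃ t z : ℂ)
    (h12 : e₁ ≠ e₂) (h13 : e₁ ≠ e₃) (h23 : e₂ ≠ e₃)
    (hq1 : b₁ ^ 2 + b₂ ^ 2 + b₃ ^ 2 = 1)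
    (hq2 : e₁ * b₁ ^ 2 + e₂ * b₂ ^ 2 + e₃ * b₃ ^ 2 = w)
    (ht : t = e₁ ^ 2 * b₁ ^ 2 + e₂ ^ 2 * b₂ ^ 2 + e₃ ^ 2 * b₃ ^ 2)
    (hz : z = b₁ * b₂ * b₃) :
    z ^ 2 * ((e₁ - e₂) ^ 2 * (e₁ - e₃) ^ 2 * (e₂ - e₃) ^ 2)
      = -((t - w * (e₁ + e₂) + e₁ * e₂) * (t - w * (e₁ + e₃) + e₁ * e₃) *
          (t - w * (e₂ + e₃) + e₂ * e₃)) := by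
  have f12 : t - w * (e₁ + e₂) + e₁ * e₂ = b₃ ^ 2 * ((e₃ - e₁) * (e₃ - e₂)) := by
    subst ht hq2
    linear_combination (-(e₁ * e₂)) * hq1
  have f13 : t - w * (e₁ + e₃) + e₁ * e₃ = b₂ ^ 2 * ((e₂ - e₁) * (e₂ - e₃)) := by
    subst ht hq2
    linear_combination (-(e₁ * e₃)) * hq1
  have f23 : t - w * (e₂ + e₃) + e₂ * e₃ = b₁ ^ 2 * ((e₁ - e₂) * (e₁ - e₃)) := by
    subst ht hq2
    linear_combination (-(e₂ * e₃)) * hq1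
  rw [f12, f13, f23, hz]
  ring
end

section
/- Let A and C be complex polynomial functions, set B = −A′ (the negative of the derivative of A), and let z* ∈ ℂ satisfy A(z*) = 0 and A′(z*) ≠ 0. Let v be a complex-valued function defined on a punctured neighborhood of z* such that A(z)·v(z)² + B(z)·v(z) + C(z) = 0 for all z in that punctured neighborhood, and such that |v(z)| → ∞ as z → z* with z ≠ z*. Then (z − z*)·v(z) → 1 as z → z* with z ≠ z*. -/
open Filter in
/-- Local behavior of the polar branch: if `A(z)v(z)² + B(z)v(z) + C(z) = 0` near a
simple zero `z*` of `A`, with `B = −A′`, and `|v(z)| → ∞` as `z → z*`, then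
`(z − z*)·v(z) → 1` as `z → z*` (i.e. `v ∼ 1/(z − z*)`). -/
theorem polar_branch_simple_pole (A C : Polynomial ℂ) (zs : ℂ)
    (hA0 : A.eval zs = 0) (hA' : A.derivative.eval zs ≠ 0)
    (v : ℂ → ℂ)
    (hquad : ∀ᶠ z in nhdsWithin zs {zs}ᶜ,
      A.eval z * (v z) ^ 2 + (-A.derivative).eval z * v z + C.eval z = 0)
    (hblow : Tendsto (fun z => ‖v z‖) (nhdsWithin zs {zs}ᶜ) atTop) :
    Tendsto (fun z => (z - zs) * v z) (nhdsWithin zs {zs}ᶜ) (nhds 1) := by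
  obtain ⟨Q, rfl⟩ := Polynomial.dvd_iff_isRoot.mpr hA0
  set A := (Polynomial.X - Polynomial.C zs) * Q with hA
  have hQ : A.derivative.eval zs = Q.eval zs := by simp [hA]
  rw [hQ] at hA'
  have hcont (P : Polynomial ℂ) :
      Tendsto (fun z => P.eval z) (nhdsWithin zs {zs}ᶜ) (nhds (P.eval zs)) :=
    P.continuous.continuousAt.tendsto.mono_left nhdsWithin_le_nhds
  have hinv : Tendsto (fun z => (v z)⁻¹) (nhdsWithin zs {zs}ᶜ) (nhds 0) :=
    tendsto_inv₀_cobounded.comp (tendsto_norm_atTop_iff_cobounded.mp hblow)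
  have hlim := ((hcont A.derivative).sub ((hcont C).mul hinv)).div (hcont Q) hA'
  rw [mul_zero, sub_zero, hQ, div_self hA'] at hlim
  refine hlim.congr' ?_
  filter_upwards [hquad, hblow.eventually_gt_atTop 0, (hcont Q).eventually_ne hA']
    with z hz hvz hQz
  have hv : v z ≠ 0 := norm_pos_iff.mp hvz
  have hAz : A.eval z = (z - zs) * Q.eval z := by simp [hA]
  rw [hAz, Polynomial.eval_neg] at hz
  simp only [Pi.div_apply]
  field_simp
  linear_combination -hz
end
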